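/- arXiv:1308.4943 — 5 statements merged into one kernel-verified Lean document; each statement's English description precedes it below -/
import Mathlib

section
/- The relation ≲P3 is contained in the relation ≲P2, which in turn is contained in the relation ≲P1: for all pairs, ⟨A1,L1⟩ ≲P3 ⟨A2,L2⟩ implies ⟨A1,L1⟩ ≲P2 ⟨A2,L2⟩, and ⟨A1,L1⟩ ≲P2 ⟨A2,L2⟩ implies ⟨A1,L1⟩ ≲P1 ⟨A2,L2⟩. -/
/-- A literal: an atom, possibly prefixed with negation. -/
inductive Lit (α : Type) : Type where
  | pos : α → Lit α
  | neg : α → Lit α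
  deriving DecidableEq

/-- A (ground) rule: a head literal together with a finite (possibly empty)
conjunction of body literals.  A rule with empty body is just a literal. -/
structure Rule (α : Type) : Type where
  head : Lit α
  body : Finset (Lit α)
  deriving DecidableEq

/-- View a set of literals as a set of bodiless rules. -/
def litRules {α : Type} (S : Set (Lit α)) : Set (Rule α) :=
  {r | r.head ∈ S ∧ r.body = ∅}

/-- The theory `𝔗_P` of a set of rules `P`: the least set of literals
containing the bodiless rules of `P` and closed under the rules of `P`. -/
inductive Th {α : Type} (P : Set (Rule α)) : Lit α → Prop where
  | step (r : Rule α) (hr : r ∈ P) (ih : ∀ l ∈ r.body, Th P l) : Th P r.head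

/-- A set of rules is contradictory iff it derives both `A` and `¬A`
for some atom `A`. -/
def Contradictory {α : Type} (P : Set (Rule α)) : Prop :=
  ∃ a : α, Th P (Lit.pos a) ∧ Th P (Lit.neg a)

/-- A defeasible specification `⟨Π^F, Π^G, Δ⟩`:
facts, general (strict) rules, and defeasible rules (all taken ground). -/
structure Spec (α : Type) : Type where
  F : Set (Lit α)
  G : Set (Rule α)
  D : Set (Rule α)

namespace Spec

variable {α : Type}

/-- `Π := Π^F ∪ Π^G`. -/
def strict (S : Spec α) : Set (Rule α) := litRules S.F ∪ S.G

/-- `𝔗_Π`. -/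
def ThStrict (S : Spec α) : Set (Lit α) := {l | Th S.strict l}

/-- `𝔗_{Π ∪ Δ}`. -/
def ThAll (S : Spec α) : Set (Lit α) := {l | Th (S.strict ∪ S.D) l}

/-- `⟨A, L⟩` is an argument: `A` is a set of (ground instances of) defeasible
rules from `Δ` and `A ∪ Π` derives `L`. -/
def IsArgument (S : Spec α) (A : Set (Rule α)) (L : Lit α) : Prop :=
  A ⊆ S.D ∧ Th (A ∪ S.strict) L

/-- `H` is a simplified activation set for `⟨A, L⟩`:  `L ∈ 𝔗_{H ∪ A ∪ Π^G}`. -/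
def SAct (S : Spec α) (A : Set (Rule α)) (L : Lit α) (H : Set (Lit α)) : Prop :=
  Th (litRules H ∪ A ∪ S.G) L

/-- `H` is an activation set for `⟨A, L⟩`:
`L ∈ 𝔗_{𝔏 ∪ Π}` for some `𝔏 ⊆ 𝔗_{H ∪ A ∪ Π^G}`. -/
def Act (S : Spec α) (A : Set (Rule α)) (L : Lit α) (H : Set (Lit α)) : Prop :=
  ∃ Ls : Set (Lit α), Ls ⊆ {l | Th (litRules H ∪ A ∪ S.G) l} ∧
    Th (litRules Ls ∪ S.strict) L

/-- `H` is a minimal simplified activation set for `⟨A, L⟩`. -/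
def MinSAct (S : Spec α) (A : Set (Rule α)) (L : Lit α) (H : Set (Lit α)) : Prop :=
  S.SAct A L H ∧ ∀ H' ⊂ H, ¬ S.SAct A L H'

/-- `H` is a minimal activation set for `⟨A, L⟩`. -/
def MinAct (S : Spec α) (A : Set (Rule α)) (L : Lit α) (H : Set (Lit α)) : Prop :=
  S.Act A L H ∧ ∀ H' ⊂ H, ¬ S.Act A L H'

/-- Poole's original specificity relation `≲P1`. -/
def leP1 (S : Spec α) (X Y : Set (Rule α) × Lit α) : Prop :=
  S.IsArgument X.1 X.2 ∧ S.IsArgument Y.1 Y.2 ∧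
    ∀ H ⊆ S.ThAll, S.SAct X.1 X.2 H → ¬ S.SAct Y.1 X.2 H → S.SAct Y.1 Y.2 H

/-- The standard version `≲P2` of Poole's specificity. -/
def leP2 (S : Spec α) (X Y : Set (Rule α) × Lit α) : Prop :=
  S.IsArgument X.1 X.2 ∧ S.IsArgument Y.1 Y.2 ∧
    ∀ H ⊆ S.ThAll, S.SAct X.1 X.2 H → ¬ S.SAct ∅ X.2 H → S.SAct Y.1 Y.2 H

/-- The rather unflawed version `≲P3` of Poole's specificity. -/
def leP3 (S : Spec α) (X Y : Set (Rule α) × Lit α) : Prop :=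
  S.IsArgument X.1 X.2 ∧ S.IsArgument Y.1 Y.2 ∧
    (Y.2 ∈ S.ThStrict → X.2 ∈ S.ThStrict) ∧
    ∀ H ⊆ S.ThAll, S.SAct X.1 X.2 H → ¬ S.SAct ∅ X.2 H → S.SAct Y.1 Y.2 H

/-- The corrected specificity relation `≲CP`. -/
def leCP (S : Spec α) (X Y : Set (Rule α) × Lit α) : Prop :=
  S.IsArgument X.1 X.2 ∧ S.IsArgument Y.1 Y.2 ∧
    (X.2 ∈ S.ThStrict ∨
      (Y.2 ∉ S.ThStrict ∧
        ∀ H ⊆ S.ThStrict, S.Act X.1 X.2 H → S.Act Y.1 Y.2 H))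

/-- `<P1 := ≲P1 \ ≳P1`. -/
def ltP1 (S : Spec α) (X Y : Set (Rule α) × Lit α) : Prop := S.leP1 X Y ∧ ¬ S.leP1 Y X
/-- `<P2 := ≲P2 \ ≳P2`. -/
def ltP2 (S : Spec α) (X Y : Set (Rule α) × Lit α) : Prop := S.leP2 X Y ∧ ¬ S.leP2 Y X
/-- `<P3 := ≲P3 \ ≳P3`. -/
def ltP3 (S : Spec α) (X Y : Set (Rule α) × Lit α) : Prop := S.leP3 X Y ∧ ¬ S.leP3 Y X
/-- `<CP := ≲CP \ ≳CP`. -/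
def ltCP (S : Spec α) (X Y : Set (Rule α) × Lit α) : Prop := S.leCP X Y ∧ ¬ S.leCP Y X

/-- `Π^{<2}`: rules of `Π` with at most one body literal. -/
def strictLt2 (S : Spec α) : Set (Rule α) := {r ∈ S.strict | r.body.card ≤ 1}

/-- `Π^{≥2}`: rules of `Π` with at least two body literals. -/
def strictGe2 (S : Spec α) : Set (Rule α) := {r ∈ S.strict | 2 ≤ r.body.card}

/-- Condition 1 of Theorem 16. -/
def Cond1 (S : Spec α) : Prop :=
  ∀ H ⊆ S.ThStrict, ∀ A ⊆ S.D,
    {l | Th (litRules {l | Th (litRules H ∪ A ∪ S.G) l} ∪ S.strict) l} ⊆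
      {l | Th (litRules H ∪ A ∪ S.G) l} ∪ S.ThStrict

/-- Condition 2 of Theorem 16. -/
def Cond2 (S : Spec α) : Prop :=
  ∀ r ∈ S.strictGe2, r.head ∉ {l | Th S.strictLt2 l} →
    ∀ l ∈ r.body, l ∉ {l | Th S.strictLt2 l}

/-- Condition 3 of Theorem 16. -/
def Cond3 (S : Spec α) : Prop :=
  ∀ r ∈ S.strictGe2, ∀ l ∈ r.body, l ∉ S.ThStrict

/-- Condition 4 of Theorem 16. -/
def Cond4 (S : Spec α) : Prop := S.strictGe2 = ∅

end Spec

/-- The theory of a set of rules is monotone in the rules. -/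
theorem Th.mono {α : Type} {P Q : Set (Rule α)} (hPQ : P ⊆ Q) {l : Lit α} (h : Th P l) :
    Th Q l := by
  induction h with
  | step r hr _ ih => exact Th.step r (hPQ hr) ih

/-- A simplified activation set remains one when defeasible rules are added. -/
theorem Spec.SAct.mono {α : Type} {S : Spec α} {A B : Set (Rule α)} (hAB : A ⊆ B) {L : Lit α}
    {H : Set (Lit α)} (h : S.SAct A L H) : S.SAct B L H :=
  Th.mono (Set.union_subset_union_left _ (Set.union_subset_union_right _ hAB)) h

/-- Corollary 12: `≲P3 ⊆ ≲P2 ⊆ ≲P1`. -/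
theorem leP3_subset_leP2_subset_leP1 {α : Type} (S : Spec α)
    (X Y : Set (Rule α) × Lit α) :
    (S.leP3 X Y → S.leP2 X Y) ∧ (S.leP2 X Y → S.leP1 X Y) := by
  refine ⟨fun ⟨hX, hY, _, hH⟩ => ⟨hX, hY, hH⟩, fun ⟨hX, hY, hH⟩ => ⟨hX, hY, ?_⟩⟩
  exact fun H hsub hact hnot =>
    hH H hsub hact fun hempty => hnot (hempty.mono (Set.empty_subset Y.1))
end

section
/- For the specification of Example 5, with arguments ⟨A1,beer⟩, ⟨A2,wine⟩, ⟨A3,vodka⟩ (each Ai minimal, i.e. no proper subset A'i ⊂ Ai makes ⟨A'i,Li⟩ an argument), the following hold: ⟨A1,beer⟩ ≲P3 ⟨A2,wine⟩ and ⟨A2,wine⟩ ≲P3 ⟨A3,vodka⟩, but NOT ⟨A1,beer⟩ ≲P1 ⟨A3,vodka⟩; moreover NOT ⟨A2,wine⟩ ≲P1 ⟨A1,beer⟩ and NOT ⟨A3,vodka⟩ ≲P1 ⟨A2,wine⟩. Note also that the specification contains no negative literals, so Π^F ∪ Π^G ∪ Δ is non-contradictory. -/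
/-- Atoms of Example 5. -/
inductive Atom5 : Type where
  | alcohol | blessing | thirst | e | beer | wine | vodka
  deriving DecidableEq

open Lit Atom5 in
/-- `A1 = {e ⤙ alcohol ∧ blessing ∧ thirst, beer ⤙ e}`. -/
def ex5A1 : Set (Rule Atom5) :=
  {⟨pos e, {pos alcohol, pos blessing, pos thirst}⟩, ⟨pos beer, {pos e}⟩}

open Lit Atom5 in
/-- `A2 = {wine ⤙ alcohol ∧ blessing}`. -/
def ex5A2 : Set (Rule Atom5) := {⟨pos wine, {pos alcohol, pos blessing}⟩}

open Lit Atom5 in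
/-- `A3 = {vodka ⤙ alcohol}`. -/
def ex5A3 : Set (Rule Atom5) := {⟨pos vodka, {pos alcohol}⟩}

open Lit Atom5 in
/-- The specification of Example 5. -/
def ex5 : Spec Atom5 where
  F := {pos alcohol, pos blessing, pos thirst}
  G := {⟨pos wine, {pos e}⟩}
  D := ex5A1 ∪ ex5A2 ∪ ex5A3

theorem Th.of_rule {α : Type} {P : Set (Rule α)} {l : Lit α} (B : Finset (Lit α))
    (hr : ⟨l, B⟩ ∈ P) (hB : ∀ b ∈ B, Th P b) : Th P l :=
  Th.step ⟨l, B⟩ hr hB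

/-- The theory of `P` is contained in every set of literals closed under `P`. -/
theorem Th.mem_of_closed {α : Type} {P : Set (Rule α)} {l : Lit α} (h : Th P l)
    (M : Set (Lit α)) (hM : ∀ r ∈ P, (∀ b ∈ r.body, b ∈ M) → r.head ∈ M) : l ∈ M := by
  induction h with
  | step r hr _ ih => exact hM r hr ih

namespace Spec

variable {α : Type} {S : Spec α} {A : Set (Rule α)} {H : Set (Lit α)} {L : Lit α}

theorem isArgument_iff : S.IsArgument A L ↔ A ⊆ S.D ∧ S.SAct A L S.F := by
  rw [IsArgument, SAct, strict, Set.union_left_comm, Set.union_assoc]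

theorem mem_thStrict_iff : L ∈ S.ThStrict ↔ S.SAct ∅ L S.F := by
  simp [ThStrict, SAct, strict]

theorem mem_thAll_iff : L ∈ S.ThAll ↔ S.SAct S.D L S.F := by
  rw [ThAll, SAct, strict, Set.union_right_comm, Set.mem_ofPred_eq]

theorem SAct.of_mem (hL : L ∈ H) : S.SAct A L H :=
  Th.of_rule ∅ (Or.inl (Or.inl ⟨hL, rfl⟩)) (by simp)

theorem SAct.of_defeasible (B : Finset (Lit α)) (hr : ⟨L, B⟩ ∈ A)
    (hB : ∀ b ∈ B, S.SAct A b H) : S.SAct A L H :=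
  Th.of_rule B (Or.inl (Or.inr hr)) hB

theorem SAct.of_general (B : Finset (Lit α)) (hr : ⟨L, B⟩ ∈ S.G)
    (hB : ∀ b ∈ B, S.SAct A b H) : S.SAct A L H :=
  Th.of_rule B (Or.inr hr) hB

theorem SAct.mem_of_closed (h : S.SAct A L H) (M : Set (Lit α)) (hH : H ⊆ M)
    (hA : ∀ r ∈ A, (∀ b ∈ r.body, b ∈ M) → r.head ∈ M)
    (hG : ∀ r ∈ S.G, (∀ b ∈ r.body, b ∈ M) → r.head ∈ M) : L ∈ M := by
  refine Th.mem_of_closed h M ?_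
  rintro r ((hr | hr) | hr)
  · exact fun _ => hH hr.1
  · exact hA r hr
  · exact hG r hr

theorem subset_thAll_of_subset_facts (hH : H ⊆ S.F) : H ⊆ S.ThAll :=
  fun _ hl => mem_thAll_iff.2 (SAct.of_mem (hH hl))

end Spec

open Lit Atom5

theorem ex5_isArgument_beer : ex5.IsArgument ex5A1 (pos beer) := by
  refine Spec.isArgument_iff.2 ⟨fun r hr => Or.inl (Or.inl hr), ?_⟩
  refine .of_defeasible {pos e} (by simp [ex5A1]) fun b hb => ?_
  obtain rfl := Finset.mem_singleton.1 hb
  refine .of_defeasible {pos alcohol, pos blessing, pos thirst} (by simp [ex5A1]) ?_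
  exact fun b hb => .of_mem (by simpa [ex5] using hb)

theorem ex5_isArgument_wine : ex5.IsArgument ex5A2 (pos wine) := by
  refine Spec.isArgument_iff.2 ⟨fun r hr => Or.inl (Or.inr hr), ?_⟩
  refine .of_defeasible {pos alcohol, pos blessing} (by simp [ex5A2]) ?_
  exact fun b hb => .of_mem (by simp [ex5] at hb ⊢; tauto)

theorem ex5_isArgument_vodka : ex5.IsArgument ex5A3 (pos vodka) := by
  refine Spec.isArgument_iff.2 ⟨fun r hr => Or.inr hr, ?_⟩
  refine .of_defeasible {pos alcohol} (by simp [ex5A3]) ?_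
  exact fun b hb => .of_mem (by simp [ex5] at hb ⊢; tauto)

theorem ex5_not_isArgument_of_ssubset_ex5A1 {A : Set (Rule Atom5)} (hA : A ⊂ ex5A1) :
    ¬ ex5.IsArgument A (pos beer) := by
  rw [Spec.isArgument_iff]
  rintro ⟨-, h⟩
  obtain ⟨r₀, hr₀, hr₀A⟩ := Set.exists_of_ssubset hA
  have hsub : ∀ r ∈ A, r ∈ ex5A1 ∧ r ≠ r₀ := fun r hr =>
    ⟨hA.subset hr, fun hrr => hr₀A (hrr ▸ hr)⟩
  rcases hr₀ with rfl | rfl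
  · have := h.mem_of_closed (insert (pos wine) ex5.F) (Set.subset_insert _ _)
      (fun r hr => by
        obtain ⟨rfl | rfl, hne⟩ := hsub r hr
        · exact absurd rfl hne
        · simp [ex5])
      (by simp [ex5])
    simp [ex5] at this
  · have := h.mem_of_closed (insert (pos e) (insert (pos wine) ex5.F))
      (fun _ hl => Or.inr (Or.inr hl))
      (fun r hr => by
        obtain ⟨rfl | rfl, hne⟩ := hsub r hr
        · simp
        · exact absurd rfl hne)
      (by simp [ex5])
    simp [ex5] at this

theorem mem_facts_of_ex5_sAct_empty {l : Lit Atom5} (h : ex5.SAct ∅ l ex5.F) : l ∈ ex5.F :=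
  h.mem_of_closed ex5.F subset_rfl (by simp) (by simp [ex5])

theorem ex5_not_sAct_wine_facts : ¬ ex5.SAct ∅ (pos wine) ex5.F :=
  fun h => by simpa [ex5] using mem_facts_of_ex5_sAct_empty h

theorem ex5_not_sAct_vodka_facts : ¬ ex5.SAct ∅ (pos vodka) ex5.F :=
  fun h => by simpa [ex5] using mem_facts_of_ex5_sAct_empty h

theorem mem_or_of_ex5_sAct_beer {H : Set (Lit Atom5)} (h : ex5.SAct ex5A1 (pos beer) H) :
    pos beer ∈ H ∨ pos e ∈ H ∨ (pos alcohol ∈ H ∧ pos blessing ∈ H ∧ pos thirst ∈ H) := by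
  by_contra! hc
  have := h.mem_of_closed (insert (pos wine) H) (Set.subset_insert _ _)
    (by simp [ex5A1, hc]; tauto) (by simp [ex5])
  simp [hc] at this

theorem mem_or_of_ex5_sAct_wine {H : Set (Lit Atom5)} (h : ex5.SAct ex5A2 (pos wine) H) :
    pos wine ∈ H ∨ pos e ∈ H ∨ (pos alcohol ∈ H ∧ pos blessing ∈ H) := by
  by_contra! hc
  have := h.mem_of_closed H subset_rfl (by simpa [ex5A2, hc] using hc.2.2) (by simp [ex5, hc])
  exact hc.1 this

theorem ex5_sAct_wine_of_mem_e {A : Set (Rule Atom5)} {H : Set (Lit Atom5)} (he : pos e ∈ H) :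
    ex5.SAct A (pos wine) H :=
  .of_general {pos e} rfl fun b hb => .of_mem (by simpa [Finset.mem_singleton.1 hb] using he)

theorem ex5_leP3_beer_wine : ex5.leP3 (ex5A1, pos beer) (ex5A2, pos wine) := by
  refine ⟨ex5_isArgument_beer, ex5_isArgument_wine, fun h => ?_, fun H _ h hn => ?_⟩
  · exact absurd (Spec.mem_thStrict_iff.1 h) ex5_not_sAct_wine_facts
  · rcases mem_or_of_ex5_sAct_beer h with hb | he | ⟨ha, hb, -⟩
    · exact absurd (.of_mem hb) hn
    · exact ex5_sAct_wine_of_mem_e he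
    · refine .of_defeasible {pos alcohol, pos blessing} rfl fun b hb => .of_mem ?_
      simp at hb
      rcases hb with rfl | rfl <;> assumption

theorem ex5_leP3_wine_vodka : ex5.leP3 (ex5A2, pos wine) (ex5A3, pos vodka) := by
  refine ⟨ex5_isArgument_wine, ex5_isArgument_vodka, fun h => ?_, fun H _ h hn => ?_⟩
  · exact absurd (Spec.mem_thStrict_iff.1 h) ex5_not_sAct_vodka_facts
  · rcases mem_or_of_ex5_sAct_wine h with hw | he | ⟨ha, -⟩
    · exact absurd (.of_mem hw) hn
    · exact absurd (ex5_sAct_wine_of_mem_e he) hn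
    · exact .of_defeasible {pos alcohol} rfl
        fun b hb => .of_mem (by simpa [Finset.mem_singleton.1 hb] using ha)

theorem ex5_not_leP1_beer_vodka : ¬ ex5.leP1 (ex5A1, pos beer) (ex5A3, pos vodka) := by
  rintro ⟨-, -, h⟩
  have hM {l : Lit Atom5} (hl : ex5.SAct ex5A3 l {pos e}) : l ∈ ({pos e, pos wine} : Set _) :=
    hl.mem_of_closed _ (by simp) (by simp [ex5A3]) (by simp [ex5])
  have := hM (h {pos e} ?_ ?_ fun hb => by simpa using hM hb)
  · simp at this
  · rw [Set.singleton_subset_iff, Spec.mem_thAll_iff]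
    refine .of_defeasible {pos alcohol, pos blessing, pos thirst} (by simp [ex5, ex5A1]) ?_
    exact fun b hb => .of_mem (by simpa [ex5] using hb)
  · exact .of_defeasible {pos e} (by simp [ex5A1])
      fun b hb => .of_mem (by simpa using hb)

theorem ex5_not_leP1_wine_beer : ¬ ex5.leP1 (ex5A2, pos wine) (ex5A1, pos beer) := by
  rintro ⟨-, -, h⟩
  have hM {l : Lit Atom5} (hl : ex5.SAct ex5A1 l {pos alcohol, pos blessing}) :
      l ∈ ({pos alcohol, pos blessing} : Set _) :=
    hl.mem_of_closed _ subset_rfl (by simp [ex5A1]) (by simp [ex5])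
  have := hM (h {pos alcohol, pos blessing} ?_ ?_ fun hw => by simpa using hM hw)
  · simp at this
  · exact Spec.subset_thAll_of_subset_facts (by simp [ex5, Set.insert_subset_iff])
  · exact .of_defeasible {pos alcohol, pos blessing} rfl
      fun b hb => .of_mem (by simpa using hb)

theorem ex5_not_leP1_vodka_wine : ¬ ex5.leP1 (ex5A3, pos vodka) (ex5A2, pos wine) := by
  rintro ⟨-, -, h⟩
  have hM {l : Lit Atom5} (hl : ex5.SAct ex5A2 l {pos alcohol}) :
      l ∈ ({pos alcohol} : Set _) :=
    hl.mem_of_closed _ subset_rfl (by simp [ex5A2]) (by simp [ex5])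
  have := hM (h {pos alcohol} ?_ ?_ fun hv => by simpa using hM hv)
  · simp at this
  · exact Spec.subset_thAll_of_subset_facts (by simp [ex5])
  · exact .of_defeasible {pos alcohol} rfl
      fun b hb => .of_mem (by simpa using hb)

theorem ex5_not_contradictory : ¬ Contradictory (litRules ex5.F ∪ ex5.G ∪ ex5.D) := by
  rintro ⟨a, -, h⟩
  have := h.mem_of_closed (Set.range pos) (by
    rintro r ((hr | hr) | hr) -
    · obtain ⟨h | h | h, -⟩ := hr <;> exact ⟨_, h.symm⟩
    · cases hr
      exact ⟨_, rfl⟩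
    · rcases hr with ((rfl | rfl) | rfl) | rfl <;> exact ⟨_, rfl⟩)
  simp at this

/-- Lemma 6 on Example 5: the sets `Ai` are minimal, the specification is
non-contradictory, `⟨A1,beer⟩ ≲P3 ⟨A2,wine⟩ ≲P3 ⟨A3,vodka⟩`, but
`¬(⟨A1,beer⟩ ≲P1 ⟨A3,vodka⟩)`, `¬(⟨A2,wine⟩ ≲P1 ⟨A1,beer⟩)` and
`¬(⟨A3,vodka⟩ ≲P1 ⟨A2,wine⟩)`. -/
theorem example5_counterexample_to_transitivity :
    (∀ A' ⊂ ex5A1, ¬ ex5.IsArgument A' (Lit.pos Atom5.beer)) ∧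
    (∀ A' ⊂ ex5A2, ¬ ex5.IsArgument A' (Lit.pos Atom5.wine)) ∧
    (∀ A' ⊂ ex5A3, ¬ ex5.IsArgument A' (Lit.pos Atom5.vodka)) ∧
    ¬ Contradictory (litRules ex5.F ∪ ex5.G ∪ ex5.D) ∧
    ex5.leP3 (ex5A1, Lit.pos Atom5.beer) (ex5A2, Lit.pos Atom5.wine) ∧
    ex5.leP3 (ex5A2, Lit.pos Atom5.wine) (ex5A3, Lit.pos Atom5.vodka) ∧
    ¬ ex5.leP1 (ex5A1, Lit.pos Atom5.beer) (ex5A3, Lit.pos Atom5.vodka) ∧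
    ¬ ex5.leP1 (ex5A2, Lit.pos Atom5.wine) (ex5A1, Lit.pos Atom5.beer) ∧
    ¬ ex5.leP1 (ex5A3, Lit.pos Atom5.vodka) (ex5A2, Lit.pos Atom5.wine) := by
  refine ⟨fun A hA => ex5_not_isArgument_of_ssubset_ex5A1 hA, fun A hA h => ?_, fun A hA h => ?_,
    ex5_not_contradictory, ex5_leP3_beer_wine, ex5_leP3_wine_vodka, ex5_not_leP1_beer_vodka,
    ex5_not_leP1_wine_beer, ex5_not_leP1_vodka_wine⟩
  · obtain rfl := Set.ssubset_singleton_iff.1 hA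
    exact ex5_not_sAct_wine_facts (Spec.isArgument_iff.1 h).2
  · obtain rfl := Set.ssubset_singleton_iff.1 hA
    exact ex5_not_sAct_vodka_facts (Spec.isArgument_iff.1 h).2
end

section
/- If the theory 𝔗_Π is finite, then the strict relation <CP := ≲CP \ ≳CP is well-founded on arguments. -/
open Classical in
/-- A rank for `<CP`: zero for strictly derivable conclusions, and otherwise one more than the
number of activation sets contained in the strict theory. -/
noncomputable def Spec.cpRank {α : Type} (S : Spec α) (X : Set (Rule α) × Lit α) : ℕ :=
  if X.2 ∈ S.ThStrict then 0 else {H | H ⊆ S.ThStrict ∧ S.Act X.1 X.2 H}.ncard + 1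

theorem Spec.cpRank_lt_of_ltCP {α : Type} {S : Spec α} (hfin : S.ThStrict.Finite)
    {X Y : Set (Rule α) × Lit α} (h : S.ltCP X Y) : S.cpRank X < S.cpRank Y := by
  obtain ⟨⟨hX, hY, hle⟩, hnot⟩ := h
  have hYs : Y.2 ∉ S.ThStrict := fun hs => hnot ⟨hY, hX, Or.inl hs⟩
  by_cases hXs : X.2 ∈ S.ThStrict
  · simp [Spec.cpRank, hXs, hYs]
  · obtain hs | ⟨-, hact⟩ := hle
    · exact absurd hs hXs
    simp only [Spec.cpRank, hXs, hYs, if_false, add_lt_add_iff_right]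
    refine Set.ncard_lt_ncard ⟨fun H hH => ⟨hH.1, hact H hH.1 hH.2⟩, fun hsub => ?_⟩
      (hfin.finite_subsets.subset fun H hH => hH.1)
    exact hnot ⟨hY, hX, Or.inr ⟨hXs, fun H hH hA => (hsub ⟨hH, hA⟩).2⟩⟩

/-- Corollary 20: if `𝔗_Π` is finite, then `<CP` is well-founded on arguments. -/
theorem ltCP_wellFounded {α : Type} (S : Spec α) (hfin : S.ThStrict.Finite) :
    WellFounded (fun X Y : {p : Set (Rule α) × Lit α // S.IsArgument p.1 p.2} =>
      S.ltCP X.val Y.val) := by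
  exact Subrelation.wf (fun h => Spec.cpRank_lt_of_ltCP hfin h)
    (measure fun X : {p : Set (Rule α) × Lit α // S.IsArgument p.1 p.2} =>
      S.cpRank X.val).wf
end

section
/- Condition 2 implies Condition 1: if for each ground instance L ← L'_0 ∧ … ∧ L'_{n+1} of a rule of Π^{≥2} with L ∉ 𝔗_{Π^{<2}} one has L'_j ∉ 𝔗_{Π^{<2}} for all j ∈ {0,…,n+1}, then for every set H ⊆ 𝔗_Π of literals and every set A of ground instances of rules from Δ, setting 𝔏 := 𝔗_{H ∪ A ∪ Π^G}, one has 𝔗_{𝔏 ∪ Π} ⊆ 𝔏 ∪ 𝔗_Π. -/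
namespace Spec

theorem strictLt2_subset_strict {α : Type} (S : Spec α) : S.strictLt2 ⊆ S.strict :=
  fun _ hr => hr.1

theorem Cond2.th_strictLt2 {α : Type} {S : Spec α} (h2 : S.Cond2) {l : Lit α}
    (h : Th S.strict l) : Th S.strictLt2 l := by
  induction h with
  | step r hr _ ih =>
    by_cases hc : r.body.card ≤ 1
    · exact .step r ⟨hr, hc⟩ ih
    · by_contra hn
      obtain ⟨l, hl⟩ : r.body.Nonempty := Finset.card_pos.mp (by lia)
      exact h2 r ⟨hr, by lia⟩ hn l hl (ih l hl)

end Spec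

/-- In Theorem 16, Condition 2 implies Condition 1. -/
theorem cond2_implies_cond1 {α : Type} (S : Spec α) (h2 : S.Cond2) : S.Cond1 := by
  intro H _ A _ l hl
  induction hl with
  | step r hr _ ih =>
    rcases hr with hr | hr
    · exact Or.inl hr.1
    by_cases hstrict : ∀ l ∈ r.body, Th S.strict l
    · exact Or.inr (Th.step r hr hstrict)
    push Not at hstrict
    obtain ⟨l, hl, hln⟩ := hstrict
    have hG : r ∈ S.G := by
      rcases hr with hF | hG
      · simp [hF.2] at hl
      · exact hG
    by_cases hc : r.body.card ≤ 1
    · refine Or.inl (Th.step r (Or.inr hG) fun l' hl' => ?_)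
      rw [Finset.card_le_one.mp hc l' hl' l hl]
      exact (ih l hl).resolve_right hln
    · by_cases hhead : Th S.strictLt2 r.head
      · exact Or.inr (hhead.mono S.strictLt2_subset_strict)
      · refine Or.inl (Th.step r (Or.inr hG) fun l' hl' => (ih l' hl').resolve_right fun h => ?_)
        exact h2 r ⟨hr, by lia⟩ hhead l' hl' (h2.th_strictLt2 h)
end

section
/- In the definition of ≲CP, restricting the universally quantified H to MINIMAL activation sets does not change the defined relation: ⟨A1,L1⟩ ≲CP ⟨A2,L2⟩ (where the quantification runs over all H ⊆ 𝔗_Π) holds if and only if the same condition holds with H additionally required to be a minimal activation set for ⟨A1,L1⟩. -/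
theorem litRules_mono {α : Type} {H K : Set (Lit α)} (h : H ⊆ K) : litRules H ⊆ litRules K :=
  fun _ hr => ⟨h hr.1, hr.2⟩

/-- Compactness of derivability: if each rule of `P H` already lies in `P K` for some finite
`K ⊆ H`, then each literal derivable from `P H` is derivable from `P K` for some finite
`K ⊆ H`. -/
theorem Th.exists_finite_subset {α β : Type} {P : Set β → Set (Rule α)} (hP : Monotone P)
    {H : Set β} (hfin : ∀ r ∈ P H, ∃ K ⊆ H, K.Finite ∧ r ∈ P K) {l : Lit α} (h : Th (P H) l) :
    ∃ K ⊆ H, K.Finite ∧ Th (P K) l := by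
  induction h with
  | step r hr _ ih =>
    obtain ⟨K₀, hK₀, hK₀fin, hrK₀⟩ := hfin r hr
    choose K hK hKfin hKTh using ih
    refine ⟨K₀ ∪ ⋃ x : {l // l ∈ r.body}, K x.1 x.2,
      Set.union_subset hK₀ (Set.iUnion_subset fun x => hK x.1 x.2),
      hK₀fin.union (Set.finite_iUnion fun x => hKfin x.1 x.2),
      Th.step r (hP Set.subset_union_left hrK₀) fun l hl => (hKTh l hl).mono (hP ?_)⟩
    exact (Set.subset_iUnion (fun x : {l // l ∈ r.body} => K x.1 x.2) ⟨l, hl⟩).trans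
      Set.subset_union_right

/-- A literal derivable from a set of literals and fixed rules is derivable from finitely many
of these literals. -/
theorem Th.exists_finite_subset_litRules {α : Type} {P : Set (Rule α)} {H : Set (Lit α)}
    {l : Lit α} (h : Th (litRules H ∪ P) l) :
    ∃ K ⊆ H, K.Finite ∧ Th (litRules K ∪ P) l := by
  refine Th.exists_finite_subset (P := fun K => litRules K ∪ P)
    (fun _ _ hK => Set.union_subset_union_left _ (litRules_mono hK)) ?_ h
  rintro r (hr | hr)
  · exact ⟨{r.head}, Set.singleton_subset_iff.2 hr.1, Set.finite_singleton _,
      Or.inl ⟨rfl, hr.2⟩⟩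
  · exact ⟨∅, Set.empty_subset _, Set.finite_empty, Or.inr hr⟩

namespace Spec

variable {α : Type} {S : Spec α} {A : Set (Rule α)} {L : Lit α} {H K : Set (Lit α)}

/-- Supersets of activation sets are activation sets. -/
theorem Act.mono (h : S.Act A L H) (hHK : H ⊆ K) : S.Act A L K := by
  obtain ⟨Ls, hLs, hTh⟩ := h
  exact ⟨Ls, fun l hl => (hLs hl).mono (Set.union_subset_union_left _
    (Set.union_subset_union_left _ (litRules_mono hHK))), hTh⟩

/-- Every activation set contains a finite one. -/
theorem Act.exists_finite_subset (h : S.Act A L H) : ∃ K ⊆ H, K.Finite ∧ S.Act A L K := by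
  obtain ⟨Ls, hLs, hTh⟩ := h
  let P : Set (Lit α) → Set (Rule α) := fun K =>
    litRules {l | Th (litRules K ∪ A ∪ S.G) l} ∪ S.strict
  have hP : Monotone P := fun _ _ hK => Set.union_subset_union_left _ (litRules_mono
    fun _ hl => hl.mono (Set.union_subset_union_left _
      (Set.union_subset_union_left _ (litRules_mono hK))))
  have hfin : ∀ r ∈ P H, ∃ K ⊆ H, K.Finite ∧ r ∈ P K := by
    rintro r (⟨hhead, hbody⟩ | hr)
    · rw [Set.mem_ofPred_eq, Set.union_assoc] at hhead
      obtain ⟨K, hK, hKfin, hKTh⟩ := hhead.exists_finite_subset_litRules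
      rw [← Set.union_assoc] at hKTh
      exact ⟨K, hK, hKfin, Or.inl ⟨hKTh, hbody⟩⟩
    · exact ⟨∅, Set.empty_subset _, Set.finite_empty, Or.inr hr⟩
  obtain ⟨K, hK, hKfin, hKTh⟩ := Th.exists_finite_subset hP hfin
    (hTh.mono (Set.union_subset_union_left _ (litRules_mono hLs)))
  exact ⟨K, hK, hKfin, _, subset_rfl, hKTh⟩

/-- Every activation set contains a minimal one. -/
theorem Act.exists_minAct_subset (h : S.Act A L H) : ∃ K ⊆ H, S.MinAct A L K := by
  obtain ⟨K, hK, hKfin, hKAct⟩ := h.exists_finite_subset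
  obtain ⟨M, hMK, hM⟩ := (hKfin.finite_subsets.subset
    (fun _ hJ => hJ.1 : {J | J ⊆ K ∧ S.Act A L J} ⊆ {J | J ⊆ K})).exists_le_minimal
    (show K ∈ {J | J ⊆ K ∧ S.Act A L J} from ⟨subset_rfl, hKAct⟩)
  exact ⟨M, hMK.trans hK, hM.prop.2, fun J hJ hJAct =>
    hM.not_prop_of_lt hJ ⟨hJ.subset.trans hMK, hJAct⟩⟩

end Spec

/-- Restricting the quantification in the definition of `≲CP` to minimal
activation sets does not change the relation. -/
theorem leCP_iff_minimal {α : Type} (S : Spec α) (X Y : Set (Rule α) × Lit α) :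
    S.leCP X Y ↔
      (S.IsArgument X.1 X.2 ∧ S.IsArgument Y.1 Y.2 ∧
        (X.2 ∈ S.ThStrict ∨
          (Y.2 ∉ S.ThStrict ∧
            ∀ H ⊆ S.ThStrict, S.MinAct X.1 X.2 H → S.Act Y.1 Y.2 H))) := by
  refine and_congr_right' (and_congr_right' (or_congr_right (and_congr_right' ?_)))
  refine ⟨fun h H hH hmin => h H hH hmin.1, fun h H hH hact => ?_⟩
  obtain ⟨K, hKH, hK⟩ := hact.exists_minAct_subset
  exact (h K (hKH.trans hH) hK).mono hKH
end
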